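/- arXiv:1803.10370 — 4 statements merged into one kernel-verified Lean document; each statement's English description precedes it below -/
import Mathlib

section
/- Let f, g : ℝ → ℝ̄ be non-decreasing functions into the extended real line. Then d_L(f⁻¹, g⁻¹) = d_L(f, g), where d_L(f,g) = inf{ y ≥ 0 : f(·−y) − y ≤ g ≤ f(·+y) + y } ∈ [0,+∞] and f⁻¹(t) = sup{ x ∈ ℝ : f(x) ≤ t } (with sup ∅ = −∞). -/
open MeasureTheory Filter Set

noncomputable section

namespace BenfordApprox

/-- Right-hand limit `f₊` of a nondecreasing `f : ℝ → ℝ̄`, at an extended-real point. -/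
def fplus (f : ℝ → EReal) (a : EReal) : EReal := sInf (f '' {x : ℝ | a < (x : EReal)})

/-- Left-hand limit `f₋` of a nondecreasing `f : ℝ → ℝ̄`, at an extended-real point. -/
def fminus (f : ℝ → EReal) (a : EReal) : EReal := sSup (f '' {x : ℝ | (x : EReal) < a})

/-- The (upper) inverse function `f⁻¹(t) = sup {x : f x ≤ t}` (with `sup ∅ = ⊥`). -/
def upperInv (f : ℝ → EReal) (t : ℝ) : EReal :=
  sSup ((fun x : ℝ => (x : EReal)) '' {x : ℝ | f x ≤ (t : EReal)})

/-- The upper inverse, for an extended-real argument. -/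
def upperInvE (f : ℝ → EReal) (t : EReal) : EReal :=
  sSup ((fun x : ℝ => (x : EReal)) '' {x : ℝ | f x ≤ t})

/-- Lévy-type distance `d_L(f,g)` between nondecreasing functions `f g : ℝ → ℝ̄`. -/
def dLfun (f g : ℝ → EReal) : EReal :=
  sInf ((fun y : ℝ => (y : EReal)) ''
    {y : ℝ | 0 ≤ y ∧ ∀ x : ℝ, f (x - y) - (y : EReal) ≤ g x ∧ g x ≤ f (x + y) + (y : EReal)})

/-- The auxiliary function `ℓ_{f,I}`; it depends on `I` only through `lo = inf I`, `hi = sup I`. -/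
def ell (f : ℝ → EReal) (lo hi : EReal) (x : ℝ) : ℝ :=
  sInf {y : ℝ | 0 ≤ y ∧ fminus f (hi - (y : EReal)) - (y : EReal) ≤ (x : EReal) ∧
    (x : EReal) ≤ fplus f (lo + (y : EReal)) + (y : EReal)}

/-- The minimal value `ℓ*_{f,I} = min {y ≥ 0 : f₋(sup I − y) − y ≤ f₊(inf I + y) + y}`. -/
def ellStar (f : ℝ → EReal) (lo hi : EReal) : ℝ :=
  sInf {y : ℝ | 0 ≤ y ∧
    fminus f (hi - (y : EReal)) - (y : EReal) ≤ fplus f (lo + (y : EReal)) + (y : EReal)}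

/-- Distribution function `F_μ(t) = μ {y ∈ 𝕀 : y ≤ t}` of `μ`, where `𝕀 = [A,B]`. -/
def cdf (μ : Measure ℝ) (A B : ℝ) (t : ℝ) : ℝ := (μ (Icc A B ∩ Iic t)).toReal

/-- `F_μ` evaluated at an extended-real point (so `F_μ(−∞) = 0`, `F_μ(+∞) = 1`). -/
def cdfE (μ : Measure ℝ) (A B : ℝ) (a : EReal) : ℝ :=
  (μ (Icc A B ∩ {y : ℝ | (y : EReal) ≤ a})).toReal

/-- Left limit `F_{μ−}` at an extended-real point (so `F_{μ−}(−∞) = 0`, `F_{μ−}(+∞) = 1`). -/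
def cdfL (μ : Measure ℝ) (A B : ℝ) (a : EReal) : ℝ :=
  sSup ((cdf μ A B) '' {t : ℝ | (t : EReal) < a})

/-- Left limit `F_{μ−}` at a real point. -/
def cdfm (μ : Measure ℝ) (A B : ℝ) (t : ℝ) : ℝ := sSup ((cdf μ A B) '' Iio t)

/-- The (upper) quantile function `F_μ⁻¹` of `μ` on `𝕀 = [A,B]`, extended monotonically to `ℝ`. -/
def quant (μ : Measure ℝ) (A B : ℝ) (t : ℝ) : ℝ :=
  if t < (μ {A}).toReal ∨ t < 0 then A
  else sSup {y ∈ Icc A B | cdf μ A B y ≤ t}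

/-- Left limit `F⁻¹_{μ−}` of the quantile function. -/
def quantm (μ : Measure ℝ) (A B : ℝ) (t : ℝ) : ℝ := sSup ((quant μ A B) '' Iio t)

/-- `F_μ` as a function into the extended reals. -/
def cdfEReal (μ : Measure ℝ) (A B : ℝ) : ℝ → EReal := fun t => ((cdf μ A B t : ℝ) : EReal)

/-- `F_μ⁻¹` as a function into the extended reals. -/
def quantEReal (μ : Measure ℝ) (A B : ℝ) : ℝ → EReal := fun t => ((quant μ A B t : ℝ) : EReal)

/-- The finitely supported measure `δ_x^p = Σ_j p_j δ_{x_j}`. -/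
def discr (n : ℕ) (x p : Fin n → ℝ) : Measure ℝ :=
  ∑ j : Fin n, ENNReal.ofReal (p j) • Measure.dirac (x j)

/-- `p ∈ Π_n`: a probability vector. -/
def IsPi (n : ℕ) (p : Fin n → ℝ) : Prop := (∀ j, 0 ≤ p j) ∧ ∑ j, p j = 1

/-- `x ∈ Ξ_n`: a nondecreasing vector of locations in `𝕀 = [A,B]`. -/
def IsXi (A B : ℝ) (n : ℕ) (x : Fin n → ℝ) : Prop := (∀ j, x j ∈ Icc A B) ∧ Monotone x

/-- The uniform weight vector `u_n = (1/n, …, 1/n)`. -/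
def unif (n : ℕ) : Fin n → ℝ := fun _ => 1 / (n : ℝ)

/-- Partial sums `P_i = Σ_{j<i} p_j` (so `P_0 = 0`, `P_n = 1`). -/
def psum (n : ℕ) (p : Fin n → ℝ) (i : ℕ) : ℝ := ∑ j : Fin n, if (j : ℕ) < i then p j else 0

/-- Locations extended by `x_0 = −∞`, `x_{n+1} = +∞`; here `extPts n x j` is the paper's `x_j`. -/
def extPts (n : ℕ) (x : Fin n → ℝ) : ℕ → EReal := fun j =>
  if hj : j = 0 then ⊥ else if h : j ≤ n then ((x ⟨j - 1, by omega⟩ : ℝ) : EReal) else ⊤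

/-- `xcoord n x j` is the paper's `x_{j+1}` (0-based access). -/
def xcoord (n : ℕ) (x : Fin n → ℝ) (j : ℕ) : ℝ := if h : j < n then x ⟨j, h⟩ else 0

/-- The normalizing constant `ω = max{1, λ(𝕀)}/λ(𝕀)` for `𝕀 = [A,B]`. -/
def omegaI (A B : ℝ) : ℝ := max 1 (B - A) / (B - A)

/-- Lévy distance between Borel measures on `𝕀 = [A,B]`. -/
def dLevy (A B : ℝ) (μ ν : Measure ℝ) : ℝ :=
  omegaI A B * sInf {y : ℝ | 0 ≤ y ∧
    ∀ t : ℝ, cdf μ A B (t - y) - y ≤ cdf ν A B t ∧ cdf ν A B t ≤ cdf μ A B (t + y) + y}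

/-- Kolmogorov (uniform) distance between Borel measures on `𝕀 = [A,B]`. -/
def dKol (A B : ℝ) (μ ν : Measure ℝ) : ℝ :=
  sSup (Set.range fun t : ℝ => |cdf μ A B t - cdf ν A B t|)

/-- `L¹`-Kantorovich distance between Borel measures on `𝕀 = [A,B]`. -/
def dKant1 (A B : ℝ) (μ ν : Measure ℝ) : ℝ :=
  (B - A)⁻¹ * ∫ y in Ioo (0 : ℝ) 1, |quant μ A B y - quant ν A B y|

/-- `L^r`-Kantorovich distance between Borel measures on `𝕀 = [A,B]`. -/
def dKant (A B r : ℝ) (μ ν : Measure ℝ) : ℝ :=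
  (B - A)⁻¹ * (∫ y in Ioo (0 : ℝ) 1, |quant μ A B y - quant ν A B y| ^ r) ^ (1 / r)

/-- The Benford measure `β_b` on `[1,b]`: the law of `b^U` with `U` uniform on `[0,1)`. -/
def benford (b : ℝ) : Measure ℝ := (volume.restrict (Ico (0 : ℝ) 1)).map (fun t : ℝ => b ^ t)

/-- The map `T_{f,a}(x) = f₊(f⁻¹(x+a) + 2a) + a`. -/
def Tmap (f : ℝ → EReal) (a : ℝ) : EReal → EReal :=
  fun x => fplus f (upperInvE f (x + (a : EReal)) + ((2 * a : ℝ) : EReal)) + (a : EReal)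

/-- The map `S_{f,a}(x) = f₊(f⁻¹(x+a)) + a`. -/
def Smap (f : ℝ → EReal) (a : ℝ) : EReal → EReal :=
  fun x => fplus f (upperInvE f (x + (a : EReal))) + (a : EReal)

/-- `L_•^{•,n} = min {a ≥ 0 : T_{F_μ,a}^{[n]}(0) ≥ 1}`. -/
def LBB (μ : Measure ℝ) (A B : ℝ) (n : ℕ) : ℝ :=
  sInf {a : ℝ | 0 ≤ a ∧ (1 : EReal) ≤ (Tmap (cdfEReal μ A B) a)^[n] ((0 : ℝ) : EReal)}

/-- `K_•^{•,n} = min {a ≥ 0 : S_{F_μ,a}^{[n]}(0) ≥ 1}`. -/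
def KBB (μ : Measure ℝ) (A B : ℝ) (n : ℕ) : ℝ :=
  sInf {a : ℝ | 0 ≤ a ∧ (1 : EReal) ≤ (Smap (cdfEReal μ A B) a)^[n] ((0 : ℝ) : EReal)}


/-- `y` is admissible in `d_L(f,g)` iff each function is dominated by the `y`-shift of the other. -/
theorem levy_bounds_iff (f g : ℝ → EReal) (y : ℝ) :
    (∀ x : ℝ, f (x - y) - (y : EReal) ≤ g x ∧ g x ≤ f (x + y) + (y : EReal)) ↔
      (∀ x : ℝ, f x ≤ g (x + y) + (y : EReal)) ∧ ∀ x : ℝ, g x ≤ f (x + y) + (y : EReal) := by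
  have key : ∀ a b : EReal, a - (y : EReal) ≤ b ↔ a ≤ b + (y : EReal) := fun a b =>
    EReal.sub_le_iff_le_add (.inl (EReal.coe_ne_bot y)) (.inl (EReal.coe_ne_top y))
  constructor
  · intro h
    refine ⟨fun x => ?_, fun x => (h x).2⟩
    simpa using (key _ _).1 (h (x + y)).1
  · rintro ⟨h₁, h₂⟩ x
    refine ⟨(key _ _).2 ?_, h₂ x⟩
    simpa using h₁ (x - y)

theorem upperInv_le_of_le_shift {f g : ℝ → EReal} {y : ℝ}
    (h : ∀ x : ℝ, f x ≤ g (x + y) + (y : EReal)) (t : ℝ) :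
    upperInv g t ≤ upperInv f (t + y) + (y : EReal) := by
  refine sSup_le ?_
  rintro _ ⟨x, hx, rfl⟩
  have hfx : f (x - y) ≤ ((t + y : ℝ) : EReal) := by
    have hxy := h (x - y)
    rw [sub_add_cancel] at hxy
    rw [EReal.coe_add]
    exact hxy.trans (add_le_add_left hx _)
  have hle : ((x - y : ℝ) : EReal) ≤ upperInv f (t + y) := le_sSup ⟨x - y, hfx, rfl⟩
  calc (x : EReal) = ((x - y : ℝ) : EReal) + (y : EReal) := by
        rw [← EReal.coe_add, sub_add_cancel]
    _ ≤ _ := add_le_add_left hle _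

theorem le_shift_of_upperInv_le {f g : ℝ → EReal} (hf : Monotone f) {y z : ℝ} (hyz : y < z)
    (h : ∀ t : ℝ, upperInv g t ≤ upperInv f (t + y) + (y : EReal)) (x : ℝ) :
    f x ≤ g (x + z) + (z : EReal) := by
  by_contra! hlt
  obtain ⟨s, hgs, hsf⟩ := EReal.lt_iff_exists_real_btwn.1 hlt
  have hg : g (x + z) ≤ ((s - z : ℝ) : EReal) := by
    rw [EReal.coe_sub]
    exact (EReal.le_sub_iff_add_le (.inl (EReal.coe_ne_bot z)) (.inl (EReal.coe_ne_top z))).2 hgs.le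
  have hle : ((x + z : ℝ) : EReal) ≤ upperInv f (s - z + y) + (y : EReal) :=
    (le_sSup ⟨x + z, hg, rfl⟩ : _ ≤ upperInv g (s - z)).trans (h _)
  have hx : (x : EReal) < upperInv f (s - z + y) := by
    refine lt_of_lt_of_le (b := ((x + z - y : ℝ) : EReal)) ?_ ?_
    · exact EReal.coe_lt_coe_iff.2 (by linarith)
    · rw [EReal.coe_sub]
      exact EReal.sub_le_of_le_add hle
  obtain ⟨_, ⟨x', hx', rfl⟩, hxx'⟩ := lt_sSup_iff.1 hx
  refine hsf.not_ge (((hf (EReal.coe_lt_coe_iff.1 hxx').le).trans hx').trans ?_)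
  exact EReal.coe_le_coe_iff.2 (by linarith)

/-- Prop. 3.2: the Lévy-type distance between nondecreasing functions
`ℝ → ℝ̄` is invariant under taking (upper) inverse functions. -/
theorem dLfun_upperInv_eq (f g : ℝ → EReal) (hf : Monotone f) (hg : Monotone g) :
    dLfun (upperInv f) (upperInv g) = dLfun f g := by
  simp only [dLfun, levy_bounds_iff]
  apply le_antisymm
  · refine sInf_le_sInf (image_mono ?_)
    rintro y ⟨hy, hfg, hgf⟩
    exact ⟨hy, upperInv_le_of_le_shift hgf, upperInv_le_of_le_shift hfg⟩
  · refine le_sInf ?_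
    rintro _ ⟨y, ⟨hy, hfg, hgf⟩, rfl⟩
    refine EReal.le_of_forall_lt_iff_le.1 fun z hz => ?_
    have hyz : y < z := EReal.coe_lt_coe_iff.1 hz
    exact sInf_le ⟨z, ⟨hy.trans hyz.le, le_shift_of_upperInv_le hf hyz hgf,
      le_shift_of_upperInv_le hg hyz hfg⟩, rfl⟩

end BenfordApprox
end
end

section
/- Let f : ℝ → ℝ̄ be non-decreasing and I ⊂ ℝ̄ an interval with f₋(sup I) < +∞ and f₊(inf I) > −∞. Then the function ℓ_{f,I} : ℝ → ℝ defined by ℓ_{f,I}(x) = inf{ y ≥ 0 : f₋(sup I − y) − y ≤ x ≤ f₊(inf I + y) + y } is Lipschitz continuous; it satisfies 0 ≤ ℓ_{f,I}(x) ≤ |x| + max{0, f₋(sup I), −f₊(inf I)} for all x ∈ ℝ; it attains a minimal value ℓ*_{f,I} := min_{x∈ℝ} ℓ_{f,I}(x) = min{ y ≥ 0 : f₋(sup I − y) − y ≤ f₊(inf I + y) + y } ≥ 0; and ℓ*_{f,I} > 0 unless f₋(sup I) ≤ f₊(inf I). -/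
open MeasureTheory Filter Set

noncomputable section

namespace BenfordApprox

theorem continuous_add_coe (c : EReal) : Continuous fun y : ℝ => c + (y : EReal) :=
  continuous_iff_continuousAt.2 fun y =>
    (EReal.continuousAt_add (p := (c, (y : EReal))) (by simp) (by simp)).comp
      (f := fun y : ℝ => (c, (y : EReal)))
      (continuous_const.prodMk continuous_coe_real_ereal).continuousAt

theorem continuous_sub_coe (c : EReal) : Continuous fun y : ℝ => c - (y : EReal) := by
  simpa [sub_eq_add_neg, Function.comp_def] using (continuous_add_coe c).comp continuous_neg

theorem fminus_mono (f : ℝ → EReal) : Monotone (fminus f) := fun _ _ hab =>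
  sSup_le_sSup (image_mono fun _ hx => lt_of_lt_of_le hx hab)

theorem fplus_mono (f : ℝ → EReal) : Monotone (fplus f) := fun _ _ hab =>
  sInf_le_sInf (image_mono fun _ hx => lt_of_le_of_lt hab hx)

/-- The lower barrier `y ↦ f₋(hi − y) − y`. -/
def lowerBarrier (f : ℝ → EReal) (hi : EReal) (y : ℝ) : EReal :=
  fminus f (hi - (y : EReal)) - (y : EReal)

/-- The upper barrier `y ↦ f₊(lo + y) + y`. -/
def upperBarrier (f : ℝ → EReal) (lo : EReal) (y : ℝ) : EReal :=
  fplus f (lo + (y : EReal)) + (y : EReal)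

theorem lowerBarrier_add_le (f : ℝ → EReal) (hi : EReal) (y : ℝ) {d : ℝ} (hd : 0 ≤ d) :
    lowerBarrier f hi (y + d) ≤ lowerBarrier f hi y - (d : EReal) := by
  have key : ∀ c : EReal, c - ((y + d : ℝ) : EReal) = c - (y : EReal) - (d : EReal) := by
    intro c
    induction c with
    | bot => simp
    | top => simp only [EReal.top_sub_coe]
    | coe c => norm_cast; ring
  unfold lowerBarrier
  rw [key (fminus _ _)]
  refine EReal.sub_le_sub (EReal.sub_le_sub (fminus_mono f ?_) le_rfl) le_rfl
  exact EReal.sub_le_sub le_rfl (by exact_mod_cast le_add_of_nonneg_right hd)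

theorem le_upperBarrier_add (f : ℝ → EReal) (lo : EReal) (y : ℝ) {d : ℝ} (hd : 0 ≤ d) :
    upperBarrier f lo y + (d : EReal) ≤ upperBarrier f lo (y + d) := by
  unfold upperBarrier
  rw [add_assoc, ← EReal.coe_add]
  gcongr
  refine fplus_mono f ?_
  gcongr
  exact le_add_of_nonneg_right hd

theorem lowerBarrier_antitone (f : ℝ → EReal) (hi : EReal) : Antitone (lowerBarrier f hi) :=
  fun _ _ h => EReal.sub_le_sub
    (fminus_mono f (EReal.sub_le_sub le_rfl (by exact_mod_cast h))) (by exact_mod_cast h)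

theorem upperBarrier_mono (f : ℝ → EReal) (lo : EReal) : Monotone (upperBarrier f lo) :=
  fun _ _ h => add_le_add
    (fplus_mono f (add_le_add le_rfl (by exact_mod_cast h))) (by exact_mod_cast h)

theorem lowerBarrier_le_iff {f : ℝ → EReal} {hi c : EReal} {y : ℝ} :
    lowerBarrier f hi y ≤ c ↔
      ∀ s : ℝ, (s : EReal) < hi - (y : EReal) → f s - (y : EReal) ≤ c := by
  have key : ∀ a : EReal, a - (y : EReal) ≤ c ↔ a ≤ c + (y : EReal) := fun a =>
    EReal.sub_le_iff_le_add (by simp) (by simp)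
  simp [lowerBarrier, key, fminus]

theorem le_upperBarrier_iff {f : ℝ → EReal} {lo c : EReal} {y : ℝ} :
    c ≤ upperBarrier f lo y ↔
      ∀ t : ℝ, lo + (y : EReal) < (t : EReal) → c ≤ f t + (y : EReal) := by
  have key : ∀ a : EReal, c ≤ a + (y : EReal) ↔ c - (y : EReal) ≤ a := fun a =>
    (EReal.sub_le_iff_le_add (by simp) (by simp)).symm
  simp [upperBarrier, key, fplus]

theorem tendsto_lowerBarrier (f : ℝ → EReal) (hi : EReal) (y : ℝ) :
    Tendsto (lowerBarrier f hi) (nhdsWithin y (Ioi y)) (nhds (lowerBarrier f hi y)) := by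
  refine tendsto_order.2 ⟨fun a ha => ?_, fun a ha => ?_⟩
  · obtain ⟨c, hac, hc⟩ := exists_between ha
    have hc' := mt lowerBarrier_le_iff.2 hc.not_ge
    push Not at hc'
    obtain ⟨s, hs, hcs⟩ := hc'
    have e1 := nhdsWithin_le_nhds (s := Ioi y)
      ((continuous_sub_coe hi).continuousAt.eventually (lt_mem_nhds hs))
    have e2 := nhdsWithin_le_nhds (s := Ioi y)
      ((continuous_sub_coe (f s)).continuousAt.eventually (lt_mem_nhds hcs))
    filter_upwards [e1, e2] with z h1 h2
    exact hac.trans (h2.trans_le (lowerBarrier_le_iff.1 le_rfl s h1))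
  · filter_upwards [self_mem_nhdsWithin] with z hz
    exact (lowerBarrier_antitone f hi (le_of_lt hz)).trans_lt ha

theorem tendsto_upperBarrier (f : ℝ → EReal) (lo : EReal) (y : ℝ) :
    Tendsto (upperBarrier f lo) (nhdsWithin y (Ioi y)) (nhds (upperBarrier f lo y)) := by
  refine tendsto_order.2 ⟨fun a ha => ?_, fun a ha => ?_⟩
  · filter_upwards [self_mem_nhdsWithin] with z hz
    exact ha.trans_le (upperBarrier_mono f lo (le_of_lt hz))
  · obtain ⟨c, hc, hca⟩ := exists_between ha
    have hc' := mt le_upperBarrier_iff.2 hc.not_ge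
    push Not at hc'
    obtain ⟨t, ht, hct⟩ := hc'
    have e1 := nhdsWithin_le_nhds (s := Ioi y)
      ((continuous_add_coe lo).continuousAt.eventually (gt_mem_nhds ht))
    have e2 := nhdsWithin_le_nhds (s := Ioi y)
      ((continuous_add_coe (f t)).continuousAt.eventually (gt_mem_nhds hct))
    filter_upwards [e1, e2] with z h1 h2
    exact ((le_upperBarrier_iff.1 le_rfl t h1).trans_lt h2).trans hca

/-- An upward closed property of nonnegative reals that is stable under limits from the right
holds at the infimum of the set it defines. -/
theorem isLeast_sInf_of_right_closed {P : ℝ → Prop} (hne : ∃ y, 0 ≤ y ∧ P y)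
    (hup : ∀ y z, y ≤ z → P y → P z)
    (hcl : ∀ y, (∀ᶠ z in nhdsWithin y (Ioi y), P z) → P y) :
    IsLeast {y : ℝ | 0 ≤ y ∧ P y} (sInf {y : ℝ | 0 ≤ y ∧ P y}) := by
  have hbdd : BddBelow {y : ℝ | 0 ≤ y ∧ P y} := ⟨0, fun y hy => hy.1⟩
  refine ⟨⟨Real.sInf_nonneg fun y hy => hy.1, hcl _ ?_⟩, fun y hy => csInf_le hbdd hy⟩
  filter_upwards [self_mem_nhdsWithin] with z hz
  obtain ⟨w, hw, hwz⟩ := (csInf_lt_iff hbdd hne).1 hz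
  exact hup w z hwz.le hw.2

theorem exists_real_mem_Icc {a b : EReal} (hab : a ≤ b) (ha : a < ⊤) (hb : ⊥ < b) :
    ∃ x : ℝ, a ≤ x ∧ (x : EReal) ≤ b := by
  rcases hab.lt_or_eq with h | rfl
  · obtain ⟨x, h1, h2⟩ := EReal.exists_between_coe_real h
    exact ⟨x, h1.le, h2.le⟩
  · exact ⟨a.toReal, EReal.le_coe_toReal ha.ne, EReal.coe_toReal_le hb.ne'⟩

theorem barriers_at_bound {f : ℝ → EReal} {lo hi : EReal} (h1 : fminus f hi < ⊤)
    (h2 : ⊥ < fplus f lo) (x : ℝ) :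
    let y := |x| + (max 0 (max (fminus f hi) (-fplus f lo))).toReal
    0 ≤ y ∧ lowerBarrier f hi y ≤ x ∧ (x : EReal) ≤ upperBarrier f lo y := by
  intro y
  set M := max 0 (max (fminus f hi) (-fplus f lo))
  have hMtop : M ≠ ⊤ := by
    refine (max_lt EReal.zero_lt_top (max_lt h1 ?_)).ne
    rw [lt_top_iff_ne_top, Ne, EReal.neg_eq_top_iff]
    exact h2.ne'
  have hM0 : 0 ≤ M.toReal := EReal.toReal_nonneg (le_max_left _ _)
  have hy : 0 ≤ y := add_nonneg (abs_nonneg x) hM0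
  have hMr : M ≤ (M.toReal : EReal) := EReal.le_coe_toReal hMtop
  have hm : fminus f hi ≤ (M.toReal : EReal) :=
    ((le_max_left _ _).trans (le_max_right _ _)).trans hMr
  have hp : ((-M.toReal : ℝ) : EReal) ≤ fplus f lo := by
    rw [EReal.coe_neg]
    exact EReal.neg_le_of_neg_le (((le_max_right _ _).trans (le_max_right _ _)).trans hMr)
  refine ⟨hy, ?_, ?_⟩
  · have h := lowerBarrier_add_le f hi 0 hy
    rw [zero_add] at h
    refine h.trans ?_
    have : lowerBarrier f hi 0 = fminus f hi := by simp [lowerBarrier]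
    rw [this]
    refine (EReal.sub_le_sub hm le_rfl).trans ?_
    norm_cast
    have := neg_abs_le x
    simp only [y]
    linarith
  · have h := le_upperBarrier_add f lo 0 hy
    rw [zero_add] at h
    refine le_trans ?_ h
    have : upperBarrier f lo 0 = fplus f lo := by simp [upperBarrier]
    rw [this]
    refine le_trans ?_ (add_le_add hp le_rfl)
    norm_cast
    have := le_abs_self x
    simp only [y]
    linarith

theorem ell_isLeast {f : ℝ → EReal} {lo hi : EReal} (h1 : fminus f hi < ⊤)
    (h2 : ⊥ < fplus f lo) (x : ℝ) :
    IsLeast {y : ℝ | 0 ≤ y ∧ lowerBarrier f hi y ≤ x ∧ (x : EReal) ≤ upperBarrier f lo y}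
      (ell f lo hi x) :=
  isLeast_sInf_of_right_closed ⟨_, barriers_at_bound h1 h2 x⟩
    (fun _ _ hyz h => ⟨(lowerBarrier_antitone f hi hyz).trans h.1,
      h.2.trans (upperBarrier_mono f lo hyz)⟩)
    (fun y h => ⟨le_of_tendsto (tendsto_lowerBarrier f hi y) (h.mono fun _ hz => hz.1),
      ge_of_tendsto (tendsto_upperBarrier f lo y) (h.mono fun _ hz => hz.2)⟩)

theorem ellStar_isLeast {f : ℝ → EReal} {lo hi : EReal} (h1 : fminus f hi < ⊤)
    (h2 : ⊥ < fplus f lo) :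
    IsLeast {y : ℝ | 0 ≤ y ∧ lowerBarrier f hi y ≤ upperBarrier f lo y} (ellStar f lo hi) :=
  isLeast_sInf_of_right_closed
    ⟨_, (barriers_at_bound h1 h2 0).1,
      (barriers_at_bound h1 h2 0).2.1.trans (barriers_at_bound h1 h2 0).2.2⟩
    (fun _ _ hyz h => ((lowerBarrier_antitone f hi hyz).trans h).trans
      (upperBarrier_mono f lo hyz))
    (fun y h => le_of_tendsto_of_tendsto (tendsto_lowerBarrier f hi y)
      (tendsto_upperBarrier f lo y) h)

theorem lipschitzWith_ell {f : ℝ → EReal} {lo hi : EReal} (h1 : fminus f hi < ⊤)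
    (h2 : ⊥ < fplus f lo) : LipschitzWith 1 (ell f lo hi) := by
  refine LipschitzWith.of_le_add fun x x' => (ell_isLeast h1 h2 x).2 ?_
  obtain ⟨h0, hA, hB⟩ := (ell_isLeast h1 h2 x').1
  have hd : 0 ≤ dist x x' := dist_nonneg
  have habs := abs_le.1 (Real.dist_eq x x').ge
  refine ⟨add_nonneg h0 hd, ?_, ?_⟩
  · refine (lowerBarrier_add_le f hi _ hd).trans ((EReal.sub_le_sub hA le_rfl).trans ?_)
    norm_cast
    linarith
  · refine le_trans (le_trans ?_ (add_le_add hB le_rfl)) (le_upperBarrier_add f lo _ hd)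
    norm_cast
    linarith

theorem exists_ell_eq_ellStar {f : ℝ → EReal} {lo hi : EReal} (h1 : fminus f hi < ⊤)
    (h2 : ⊥ < fplus f lo) : ∃ x₀ : ℝ, ell f lo hi x₀ = ellStar f lo hi := by
  have hS := ellStar_isLeast h1 h2
  obtain ⟨h0, hAB⟩ := hS.1
  have hA : lowerBarrier f hi (ellStar f lo hi) < ⊤ :=
    (lowerBarrier_antitone f hi h0).trans_lt (by simpa [lowerBarrier] using h1)
  have hB : ⊥ < upperBarrier f lo (ellStar f lo hi) :=
    lt_of_lt_of_le (by simpa [upperBarrier] using h2) (upperBarrier_mono f lo h0)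
  obtain ⟨x₀, hx⟩ := exists_real_mem_Icc hAB hA hB
  have hx₀ := ell_isLeast h1 h2 x₀
  exact ⟨x₀, le_antisymm (hx₀.2 ⟨h0, hx⟩) (hS.2 ⟨hx₀.1.1, hx₀.1.2.1.trans hx₀.1.2.2⟩)⟩

/-- Prop. 3.3: basic properties of the auxiliary function `ℓ_{f,I}`. -/
theorem ell_properties (f : ℝ → EReal) (hf : Monotone f) (I : Set EReal)
    (hI : I.OrdConnected) (h1 : fminus f (sSup I) < ⊤) (h2 : ⊥ < fplus f (sInf I)) :
    (∃ K : NNReal, LipschitzWith K (ell f (sInf I) (sSup I))) ∧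
    (∀ x : ℝ, 0 ≤ ell f (sInf I) (sSup I) x ∧
      ell f (sInf I) (sSup I) x ≤
        |x| + (max 0 (max (fminus f (sSup I)) (-fplus f (sInf I)))).toReal) ∧
    (∃ x₀ : ℝ, (∀ x : ℝ, ell f (sInf I) (sSup I) x₀ ≤ ell f (sInf I) (sSup I) x) ∧
      IsLeast {y : ℝ | 0 ≤ y ∧
          fminus f (sSup I - (y : EReal)) - (y : EReal) ≤
            fplus f (sInf I + (y : EReal)) + (y : EReal)}
        (ell f (sInf I) (sSup I) x₀) ∧
      (¬ fminus f (sSup I) ≤ fplus f (sInf I) → 0 < ell f (sInf I) (sSup I) x₀)) := by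
  refine ⟨⟨1, lipschitzWith_ell h1 h2⟩, fun x => ⟨(ell_isLeast h1 h2 x).1.1,
    (ell_isLeast h1 h2 x).2 (barriers_at_bound h1 h2 x)⟩, ?_⟩
  have hS := ellStar_isLeast h1 h2
  obtain ⟨x₀, hx₀⟩ := exists_ell_eq_ellStar h1 h2
  refine ⟨x₀, fun x => ?_, hx₀ ▸ hS, fun hn => ?_⟩
  · have hx := (ell_isLeast h1 h2 x).1
    exact hx₀ ▸ hS.2 ⟨hx.1, hx.2.1.trans hx.2.2⟩
  · rw [hx₀]
    refine hS.1.1.lt_of_ne fun h => hn ?_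
    simpa [← h, lowerBarrier, upperBarrier] using hS.1.2

end BenfordApprox
end
end

section
/- Let μ be a Borel probability measure on a compact interval 𝕀 ⊂ ℝ of positive length, and n ∈ ℕ. Then for every x ∈ Ξ_n and p ∈ Π_n, the Lévy distance satisfies d_L(μ, δ_x^p) = ω · max_{j=0,…,n} ℓ_{F_μ,[x_j,x_{j+1}]}(P_j) = ω · max_{j=1,…,n} ℓ_{F_μ⁻¹,[P_{j−1},P_j]}(x_j), where x_0 := −∞ and x_{n+1} := +∞. -/
open MeasureTheory Filter Set

noncomputable section

namespace BenfordApprox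

/-- Membership in the set defining `ell`, written without one-sided limits. -/
theorem ell_conditions_iff (g : ℝ → ℝ) (lo hi : EReal) (x y : ℝ) :
    (fminus (fun t => (g t : EReal)) (hi - (y : EReal)) - (y : EReal) ≤ (x : EReal) ∧
      (x : EReal) ≤ fplus (fun t => (g t : EReal)) (lo + (y : EReal)) + (y : EReal)) ↔
    (∀ t : ℝ, (t : EReal) < hi → g (t - y) - y ≤ x) ∧
      ∀ t : ℝ, lo < (t : EReal) → x ≤ g (t + y) + y := by
  have hy1 : (y : EReal) ≠ ⊥ := EReal.coe_ne_bot y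
  have hy2 : (y : EReal) ≠ ⊤ := EReal.coe_ne_top y
  have hleft : ∀ s : ℝ, (s : EReal) < hi - (y : EReal) ↔ ((s + y : ℝ) : EReal) < hi := by
    intro s
    rw [EReal.coe_add]
    exact EReal.lt_sub_iff_add_lt (Or.inl hy1) (Or.inl hy2)
  have hright : ∀ s : ℝ, lo + (y : EReal) < (s : EReal) ↔ lo < ((s - y : ℝ) : EReal) := by
    intro s
    rw [EReal.coe_sub]
    exact (EReal.lt_sub_iff_add_lt (Or.inl hy1) (Or.inl hy2)).symm
  refine and_congr ?_ ?_
  · rw [EReal.sub_le_iff_le_add (Or.inl hy1) (Or.inl hy2), fminus, sSup_le_iff, forall_mem_image]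
    simp only [mem_ofPred_eq, hleft, ← EReal.coe_add, EReal.coe_le_coe_iff]
    constructor
    · intro h t ht
      have := @h (t - y) (by simpa using ht)
      linarith
    · intro h s hs
      have := h (s + y) hs
      rw [add_sub_cancel_right] at this
      linarith
  · rw [← EReal.sub_le_iff_le_add (Or.inl hy1) (Or.inl hy2), fplus, le_sInf_iff, forall_mem_image]
    simp only [mem_ofPred_eq, hright, ← EReal.coe_sub, EReal.coe_le_coe_iff]
    constructor
    · intro h t ht
      have := @h (t + y) (by simpa using ht)
      linarith
    · intro h s hs
      have := h (s - y) hs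
      rw [sub_add_cancel] at this
      linarith

/-- The set of admissible shifts whose infimum is `ell`. -/
def ellSet (g : ℝ → ℝ) (lo hi : EReal) (x : ℝ) : Set ℝ :=
  {y : ℝ | 0 ≤ y ∧ (∀ t : ℝ, (t : EReal) < hi → g (t - y) - y ≤ x) ∧
    ∀ t : ℝ, lo < (t : EReal) → x ≤ g (t + y) + y}

theorem ell_eq_sInf_ellSet (g : ℝ → ℝ) (lo hi : EReal) (x : ℝ) :
    ell (fun t => (g t : EReal)) lo hi x = sInf (ellSet g lo hi x) := by
  simp only [ell, ellSet, ell_conditions_iff]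

theorem isUpperSet_ellSet {g : ℝ → ℝ} (hg : Monotone g) (lo hi : EReal) (x : ℝ) :
    IsUpperSet (ellSet g lo hi x) := by
  rintro y y' hyy ⟨h0, h1, h2⟩
  refine ⟨h0.trans hyy, fun t ht => ?_, fun t ht => ?_⟩
  · have := hg (show t - y' ≤ t - y by linarith)
    linarith [h1 t ht]
  · have := hg (show t + y ≤ t + y' by linarith)
    linarith [h2 t ht]

/-- The infimum of a set of reals that is, up to its boundary, the intersection of finitely many
upper sets is the maximum of their infima. -/
theorem sInf_eq_sup'_sInf {ι : Type*} {s : Finset ι} (hs : s.Nonempty) {S : Set ℝ}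
    {T : ι → Set ℝ} (hS : S.Nonempty) (hbdd : ∀ i ∈ s, BddBelow (T i))
    (hup : ∀ i ∈ s, IsUpperSet (T i)) (hST : ∀ i ∈ s, S ⊆ T i)
    (hTS : ∀ y y', (∀ i ∈ s, y ∈ T i) → y < y' → y' ∈ S) :
    sInf S = s.sup' hs fun i => sInf (T i) := by
  obtain ⟨i₀, hi₀⟩ := hs
  have hbS : BddBelow S := (hbdd i₀ hi₀).mono (hST i₀ hi₀)
  apply le_antisymm
  · refine le_of_forall_gt_imp_ge_of_dense fun c hc => ?_
    obtain ⟨d, hd, hdc⟩ := exists_between hc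
    refine csInf_le hbS (hTS d c (fun i hi => ?_) hdc)
    obtain ⟨z, hz, hzd⟩ := exists_lt_of_csInf_lt (hS.mono (hST i hi))
      (lt_of_le_of_lt (Finset.le_sup' (fun i => sInf (T i)) hi) hd)
    exact hup i hi hzd.le hz
  · exact Finset.sup'_le _ _ fun i hi => csInf_le_csInf (hbdd i hi) hS (hST i hi)

section Cdf

variable {A B : ℝ} {μ : Measure ℝ}

theorem cdf_nonneg (t : ℝ) : 0 ≤ cdf μ A B t := ENNReal.toReal_nonneg

theorem cdf_monotone [IsProbabilityMeasure μ] : Monotone (cdf μ A B) := fun _ _ h =>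
  ENNReal.toReal_mono (measure_ne_top _ _)
    (measure_mono (inter_subset_inter_right _ (Iic_subset_Iic.mpr h)))

theorem cdf_le_one [IsProbabilityMeasure μ] (t : ℝ) : cdf μ A B t ≤ 1 :=
  ENNReal.toReal_le_of_le_ofReal zero_le_one (by simpa using prob_le_one)

theorem cdf_of_lt {t : ℝ} (ht : t < A) : cdf μ A B t = 0 := by
  have : Icc A B ∩ Iic t = ∅ := by
    ext z
    simp only [mem_inter_iff, mem_Icc, mem_Iic, mem_empty_iff_false, iff_false]
    rintro ⟨⟨h1, -⟩, h2⟩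
    linarith
  simp [cdf, this]

theorem cdf_of_ge (hμ : μ (Icc A B) = 1) {t : ℝ} (ht : B ≤ t) : cdf μ A B t = 1 := by
  have : Icc A B ∩ Iic t = Icc A B := inter_eq_left.mpr fun z hz => hz.2.trans ht
  simp [cdf, this, hμ]

theorem cdf_left (hAB : A ≤ B) : cdf μ A B A = (μ {A}).toReal := by
  have : Icc A B ∩ Iic A = {A} := by
    ext z
    simp only [mem_inter_iff, mem_Icc, mem_Iic, mem_singleton_iff]
    constructor
    · rintro ⟨⟨h1, -⟩, h2⟩
      exact le_antisymm h2 h1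
    · rintro rfl
      exact ⟨⟨le_rfl, hAB⟩, le_rfl⟩
  rw [cdf, this]

theorem bddAbove_cdf_sublevel (s : ℝ) : BddAbove {y ∈ Icc A B | cdf μ A B y ≤ s} :=
  ⟨B, fun _ hy => hy.1.2⟩

theorem left_le_quant (hAB : A ≤ B) (s : ℝ) : A ≤ quant μ A B s := by
  unfold quant
  split_ifs with h
  · exact le_rfl
  · push Not at h
    exact le_csSup (bddAbove_cdf_sublevel s) ⟨⟨le_rfl, hAB⟩, (cdf_left hAB).trans_le h.1⟩

/-- An upper bound for the cdf sublevel set bounds the quantile. -/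
theorem quant_le (hAB : A ≤ B) {s c : ℝ} (hA : A ≤ c)
    (hc : ∀ y ∈ Icc A B, cdf μ A B y ≤ s → y ≤ c) : quant μ A B s ≤ c := by
  unfold quant
  split_ifs with h
  · exact hA
  · push Not at h
    exact csSup_le ⟨A, ⟨le_rfl, hAB⟩, (cdf_left hAB).trans_le h.1⟩ fun y hy => hc y hy.1 hy.2

theorem le_quant [IsProbabilityMeasure μ] {s z : ℝ} (hz : z ∈ Icc A B) (h : cdf μ A B z ≤ s) :
    z ≤ quant μ A B s := by
  have hA : (μ {A}).toReal ≤ s := by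
    rw [← cdf_left (hz.1.trans hz.2)]
    exact (cdf_monotone hz.1).trans h
  rw [quant, if_neg (by
    push Not
    exact ⟨hA, (cdf_nonneg z).trans h⟩)]
  exact le_csSup (bddAbove_cdf_sublevel s) ⟨hz, h⟩

theorem quant_monotone [IsProbabilityMeasure μ] (hAB : A ≤ B) : Monotone (quant μ A B) :=
  fun _ s' hs => quant_le hAB (left_le_quant hAB s') fun _ hy h => le_quant hy (h.trans hs)

theorem cdf_le_of_lt_quant [IsProbabilityMeasure μ] (hAB : A ≤ B) {s z : ℝ} (hs : 0 ≤ s)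
    (hz : z < quant μ A B s) : cdf μ A B z ≤ s := by
  rcases lt_or_ge z A with hzA | hzA
  · rwa [cdf_of_lt hzA]
  · by_contra! h
    refine hz.not_ge (quant_le hAB hzA fun y _ hys => ?_)
    by_contra! hzy
    linarith [cdf_monotone (μ := μ) (A := A) (B := B) hzy.le]

theorem le_cdf_of_quant_lt [IsProbabilityMeasure μ] (hμ : μ (Icc A B) = 1) (hAB : A ≤ B)
    {s z : ℝ} (hs : s ≤ 1) (hz : quant μ A B s < z) : s ≤ cdf μ A B z := by
  rcases le_or_gt B z with hzB | hzB
  · rwa [cdf_of_ge hμ hzB]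
  · by_contra! h
    exact hz.not_ge (le_quant ⟨(left_le_quant hAB s).trans hz.le, hzB.le⟩ h.le)

end Cdf

section Discrete

variable {A B : ℝ} {n : ℕ} {x p : Fin n → ℝ}

theorem cdf_discr (hx : IsXi A B n x) (hp : IsPi n p) (t : ℝ) :
    cdf (discr n x p) A B t = ∑ j, if x j ≤ t then p j else 0 := by
  have hmeas : MeasurableSet (Icc A B ∩ Iic t) := measurableSet_Icc.inter measurableSet_Iic
  simp only [cdf, discr, Measure.coe_finsetSum, Finset.sum_apply, Measure.smul_apply,
    Measure.dirac_apply' _ hmeas, smul_eq_mul]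
  rw [ENNReal.toReal_sum fun j _ => ENNReal.mul_ne_top ENNReal.ofReal_ne_top (by
    by_cases h : x j ∈ Icc A B ∩ Iic t <;> simp [h])]
  refine Finset.sum_congr rfl fun j _ => ?_
  by_cases h : x j ≤ t
  · have hmem : x j ∈ Icc A B ∩ Iic t := ⟨hx.1 j, h⟩
    rw [indicator_of_mem hmem, if_pos h]
    simp [ENNReal.toReal_ofReal (hp.1 j)]
  · have hmem : x j ∉ Icc A B ∩ Iic t := fun hm => h hm.2
    rw [indicator_of_notMem hmem, if_neg h]
    simp

theorem extPts_succ (j : Fin n) : extPts n x ((j : ℕ) + 1) = (x j : EReal) := by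
  simp [extPts, Nat.succ_le_of_lt j.isLt]

theorem psum_nonneg (hp : IsPi n p) (i : ℕ) : 0 ≤ psum n p i :=
  Finset.sum_nonneg fun j _ => by
    split_ifs
    exacts [hp.1 j, le_rfl]

theorem psum_le_one (hp : IsPi n p) (i : ℕ) : psum n p i ≤ 1 := by
  rw [← hp.2]
  refine Finset.sum_le_sum fun j _ => ?_
  split_ifs
  exacts [le_rfl, hp.1 j]

theorem psum_zero : psum n p 0 = 0 := by simp [psum]

theorem psum_self (hp : IsPi n p) : psum n p n = 1 := by simp [psum, hp.2]

theorem cdf_discr_le_psum (hx : IsXi A B n x) (hp : IsPi n p) {j : ℕ} {t : ℝ}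
    (ht : (t : EReal) < extPts n x (j + 1)) : cdf (discr n x p) A B t ≤ psum n p j := by
  rw [cdf_discr hx hp]
  refine Finset.sum_le_sum fun i _ => ?_
  by_cases hi : (i : ℕ) < j
  · rw [if_pos hi]
    split_ifs
    exacts [le_rfl, hp.1 i]
  · have hj : j < n := by omega
    rw [extPts_succ ⟨j, hj⟩, EReal.coe_lt_coe_iff] at ht
    have : x ⟨j, hj⟩ ≤ x i := hx.2 (Fin.mk_le_of_le_val (by omega))
    rw [if_neg hi, if_neg (by linarith)]

theorem psum_le_cdf_discr (hx : IsXi A B n x) (hp : IsPi n p) {j : ℕ} (hj : j ≤ n) {t : ℝ}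
    (ht : extPts n x j ≤ (t : EReal)) : psum n p j ≤ cdf (discr n x p) A B t := by
  rw [cdf_discr hx hp]
  refine Finset.sum_le_sum fun i _ => ?_
  by_cases hi : (i : ℕ) < j
  · obtain ⟨k, rfl⟩ : ∃ k, j = k + 1 := ⟨j - 1, by omega⟩
    rw [extPts_succ ⟨k, hj⟩, EReal.coe_le_coe_iff] at ht
    have : x i ≤ x ⟨k, hj⟩ := hx.2 (show (i : ℕ) ≤ k by omega)
    rw [if_pos hi, if_pos (by linarith)]
  · rw [if_neg hi]
    split_ifs
    exacts [hp.1 i, le_rfl]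

theorem exists_extPts_le_lt (n : ℕ) (x : Fin n → ℝ) (t : ℝ) :
    ∃ j ≤ n, extPts n x j ≤ (t : EReal) ∧ (t : EReal) < extPts n x (j + 1) := by
  classical
  let P : ℕ → Prop := fun j => extPts n x j ≤ (t : EReal)
  refine ⟨Nat.findGreatest P n, Nat.findGreatest_le n, ?_, ?_⟩
  · exact Nat.findGreatest_spec (P := P) (Nat.zero_le n) (by simp [P, extPts])
  · rcases (Nat.findGreatest_le (P := P) n).lt_or_eq with h | h
    · exact not_le.mp (Nat.findGreatest_is_greatest (P := P) (Nat.lt_succ_self _) h)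
    · rw [h]
      simp [extPts, EReal.coe_lt_top]

theorem exists_cdf_discr_eq_psum (hx : IsXi A B n x) (hp : IsPi n p) (t : ℝ) :
    ∃ j ≤ n, extPts n x j ≤ (t : EReal) ∧ (t : EReal) < extPts n x (j + 1) ∧
      cdf (discr n x p) A B t = psum n p j := by
  obtain ⟨j, hj, h1, h2⟩ := exists_extPts_le_lt n x t
  exact ⟨j, hj, h1, h2,
    le_antisymm (cdf_discr_le_psum hx hp h2) (psum_le_cdf_discr hx hp hj h1)⟩

end Discrete

/-- The set of admissible shifts whose infimum is the unnormalized Lévy distance. -/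
def levySet (A B : ℝ) (μ ν : Measure ℝ) : Set ℝ :=
  {y : ℝ | 0 ≤ y ∧
    ∀ t : ℝ, cdf μ A B (t - y) - y ≤ cdf ν A B t ∧ cdf ν A B t ≤ cdf μ A B (t + y) + y}

section Levy

variable {A B : ℝ} {μ : Measure ℝ} {n : ℕ} {x p : Fin n → ℝ}

theorem one_mem_levySet [IsProbabilityMeasure μ] (hx : IsXi A B n x) (hp : IsPi n p) :
    (1 : ℝ) ∈ levySet A B μ (discr n x p) := by
  refine ⟨zero_le_one, fun t => ?_⟩
  obtain ⟨j, -, -, -, h⟩ := exists_cdf_discr_eq_psum hx hp t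
  have := psum_le_one hp j
  have := psum_nonneg hp j
  have := cdf_le_one (μ := μ) (A := A) (B := B) (t - 1)
  have := cdf_nonneg (μ := μ) (A := A) (B := B) (t + 1)
  constructor <;> linarith

theorem levySet_subset_ellSet_cdf (hx : IsXi A B n x) (hp : IsPi n p) {j : ℕ} (hj : j ≤ n) :
    levySet A B μ (discr n x p) ⊆
      ellSet (cdf μ A B) (extPts n x j) (extPts n x (j + 1)) (psum n p j) :=
  fun _ hy => ⟨hy.1, fun t ht => (hy.2 t).1.trans (cdf_discr_le_psum hx hp ht),
    fun t ht => (psum_le_cdf_discr hx hp hj ht.le).trans (hy.2 t).2⟩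

theorem mem_levySet_of_forall_mem_ellSet_cdf [IsProbabilityMeasure μ]
    (hx : IsXi A B n x) (hp : IsPi n p) {y y' : ℝ}
    (hy : ∀ j ≤ n, y ∈ ellSet (cdf μ A B) (extPts n x j) (extPts n x (j + 1)) (psum n p j))
    (hyy : y < y') : y' ∈ levySet A B μ (discr n x p) := by
  have hy0 : 0 ≤ y := (hy 0 (Nat.zero_le n)).1
  refine ⟨hy0.trans hyy.le, fun t => ?_⟩
  obtain ⟨j, hj, h1, h2, h⟩ := exists_cdf_discr_eq_psum hx hp t
  obtain ⟨-, hleft, hright⟩ := hy j hj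
  rw [h]
  constructor
  · have := cdf_monotone (μ := μ) (A := A) (B := B) (show t - y' ≤ t - y by linarith)
    linarith [hleft t h2]
  · have := hright (t + (y' - y))
      (h1.trans_lt (EReal.coe_lt_coe_iff.mpr (by linarith)))
    rw [show t + (y' - y) + y = t + y' by ring] at this
    linarith

theorem levySet_subset_ellSet_quant [IsProbabilityMeasure μ] (hAB : A ≤ B)
    (hx : IsXi A B n x) (hp : IsPi n p) (j : Fin n) :
    levySet A B μ (discr n x p) ⊆
      ellSet (quant μ A B) (psum n p (j : ℕ) : ℝ) (psum n p ((j : ℕ) + 1) : ℝ) (x j) := by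
  rintro y ⟨hy0, hy⟩
  have hxj := hx.1 j
  refine ⟨hy0, fun t ht => ?_, fun t ht => ?_⟩
  · rw [EReal.coe_lt_coe_iff] at ht
    have hP := psum_le_cdf_discr hx hp (Nat.succ_le_of_lt j.isLt) (extPts_succ (x := x) j).le
    have hF := (hy (x j)).2
    have : quant μ A B (t - y) ≤ x j + y := by
      refine quant_le hAB (by linarith [hxj.1]) fun z _ hz => ?_
      by_contra! hlt
      linarith [cdf_monotone (μ := μ) (A := A) (B := B) hlt.le]
    linarith
  · rw [EReal.coe_lt_coe_iff] at ht
    refine le_of_forall_lt_imp_le_of_dense fun r hr => ?_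
    have hP := cdf_discr_le_psum hx hp (j := (j : ℕ)) (t := r) (by
      rw [extPts_succ]
      exact EReal.coe_lt_coe_iff.mpr hr)
    have hF := (hy r).1
    rcases lt_or_ge (r - y) A with h | h
    · linarith [left_le_quant (μ := μ) hAB (t + y)]
    · have := le_quant (μ := μ) (B := B) (s := t + y) ⟨h, by linarith [hxj.2]⟩ (by linarith)
      linarith

theorem mem_levySet_of_forall_mem_ellSet_quant [IsProbabilityMeasure μ]
    (hμ : μ (Icc A B) = 1) (hAB : A ≤ B) (hn : 0 < n) (hx : IsXi A B n x) (hp : IsPi n p) {y y' : ℝ}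
    (hy : ∀ j : Fin n, y ∈
      ellSet (quant μ A B) (psum n p (j : ℕ) : ℝ) (psum n p ((j : ℕ) + 1) : ℝ) (x j))
    (hyy : y < y') : y' ∈ levySet A B μ (discr n x p) := by
  have hy0 : 0 ≤ y := (hy ⟨0, hn⟩).1
  refine ⟨hy0.trans hyy.le, fun t => ?_⟩
  obtain ⟨k, hk, h1, h2, h⟩ := exists_cdf_discr_eq_psum hx hp t
  have hP0 := psum_nonneg hp k
  have hP1 := psum_le_one hp k
  rw [h]
  constructor
  · rcases hk.lt_or_eq with hkn | rfl
    · obtain ⟨-, -, hright⟩ := hy ⟨k, hkn⟩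
      have hq := hright (psum n p k + (y' - y)) (EReal.coe_lt_coe_iff.mpr (by simpa using hyy))
      rw [show psum n p k + (y' - y) + y = psum n p k + y' by ring] at hq
      rw [extPts_succ ⟨k, hkn⟩, EReal.coe_lt_coe_iff] at h2
      have := cdf_le_of_lt_quant (μ := μ) hAB (s := psum n p k + y') (z := t - y')
        (by linarith) (by linarith)
      linarith
    · rw [psum_self hp]
      linarith [cdf_le_one (μ := μ) (A := A) (B := B) (t - y')]
  · rcases Nat.eq_zero_or_pos k with rfl | hk0
    · rw [psum_zero]
      linarith [cdf_nonneg (μ := μ) (A := A) (B := B) (t + y')]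
    · obtain ⟨i, rfl⟩ : ∃ i, k = i + 1 := ⟨k - 1, by omega⟩
      obtain ⟨-, hleft, -⟩ := hy ⟨i, hk⟩
      have hq := hleft (psum n p (i + 1) - (y' - y))
        (EReal.coe_lt_coe_iff.mpr (by simpa using hyy))
      rw [show psum n p (i + 1) - (y' - y) - y = psum n p (i + 1) - y' by ring] at hq
      rw [extPts_succ ⟨i, hk⟩, EReal.coe_le_coe_iff] at h1
      have := le_cdf_of_quant_lt hμ hAB (s := psum n p (i + 1) - y') (z := t + y')
        (by linarith) (by linarith)
      linarith

end Levy

/-- Lemma 3.4: the Lévy distance `d_L(μ, δ_x^p)` in terms of the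
auxiliary functions `ℓ_{F_μ,[x_j,x_{j+1}]}` and `ℓ_{F_μ⁻¹,[P_{j−1},P_j]}`. -/
theorem dLevy_discr_eq (A B : ℝ) (hAB : A < B) (μ : Measure ℝ) [IsProbabilityMeasure μ]
    (hμ : μ (Icc A B) = 1) (n : ℕ) (hn : 0 < n)
    (x : Fin n → ℝ) (hx : IsXi A B n x) (p : Fin n → ℝ) (hp : IsPi n p) :
    dLevy A B μ (discr n x p) =
      omegaI A B *
        Finset.sup' (Finset.range (n + 1)) (Finset.nonempty_range_iff.mpr (Nat.succ_ne_zero n))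
          (fun j => ell (cdfEReal μ A B) (extPts n x j) (extPts n x (j + 1)) (psum n p j)) ∧
    dLevy A B μ (discr n x p) =
      omegaI A B *
        Finset.sup' Finset.univ ⟨⟨0, hn⟩, Finset.mem_univ _⟩
          (fun j : Fin n => ell (quantEReal μ A B)
            ((psum n p (j : ℕ) : ℝ) : EReal) ((psum n p ((j : ℕ) + 1) : ℝ) : EReal) (x j)) := by
  have hne : (levySet A B μ (discr n x p)).Nonempty := ⟨1, one_mem_levySet hx hp⟩
  have hbdd : ∀ (g : ℝ → ℝ) (lo hi : EReal) (z : ℝ), BddBelow (ellSet g lo hi z) :=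
    fun _ _ _ _ => ⟨0, fun _ hy => hy.1⟩
  refine ⟨congrArg (omegaI A B * ·) ?_, congrArg (omegaI A B * ·) ?_⟩
  · refine (sInf_eq_sup'_sInf (s := Finset.range (n + 1)) ⟨0, by simp⟩ hne
      (fun _ _ => hbdd _ _ _ _) (fun _ _ => isUpperSet_ellSet cdf_monotone _ _ _)
      (fun j hj => levySet_subset_ellSet_cdf hx hp (Finset.mem_range_succ_iff.mp hj))
      fun y y' hy hyy => mem_levySet_of_forall_mem_ellSet_cdf hx hp
        (fun j hj => hy j (Finset.mem_range_succ_iff.mpr hj)) hyy).trans ?_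
    exact Finset.sup'_congr _ rfl fun j _ => (ell_eq_sInf_ellSet _ _ _ _).symm
  · refine (sInf_eq_sup'_sInf (s := Finset.univ) ⟨⟨0, hn⟩, Finset.mem_univ _⟩ hne
      (fun _ _ => hbdd _ _ _ _) (fun _ _ => isUpperSet_ellSet (quant_monotone hAB.le) _ _ _)
      (fun j _ => levySet_subset_ellSet_quant hAB.le hx hp j)
      fun y y' hy hyy => mem_levySet_of_forall_mem_ellSet_quant hμ hAB.le hn hx hp
        (fun j => hy j (Finset.mem_univ j)) hyy).trans ?_
    exact Finset.sup'_congr _ rfl fun j _ => (ell_eq_sInf_ellSet _ _ _ _).symm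

end BenfordApprox
end
end

section
/- Let b > 1 and n ∈ ℕ. Then δ_x^{u_n} (with x ∈ Ξ_n) is a best uniform Lévy-distance approximation of the Benford measure β_b if and only if b^{j/n − L} − L ≤ x_j ≤ b^{(j−1)/n + L} + L for all j = 1,…,n, where L is the unique solution of 2L = b^{1−L} − b^{1+L−1/n}; in particular every best uniform approximation has support of cardinality exactly n. Moreover d_L(β_b, δ_x^{u_n}) = ω_b · L for any such best approximation, and lim_{n→∞} n · min_{x∈Ξ_n} d_L(β_b, δ_x^{u_n}) = ((max{b,2} − 1)/(2b − 2)) · (b log b)/(1 + b log b). -/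
open MeasureTheory Filter Set

noncomputable section

namespace BenfordApprox

/-! ### The distribution function of the Benford measure -/

lemma cdf_benford_eq (b : ℝ) (hb : 1 < b) (t : ℝ) :
    cdf (benford b) 1 b t =
      (volume (((fun u : ℝ => b ^ u) ⁻¹' (Icc 1 b ∩ Iic t)) ∩ Ico (0 : ℝ) 1)).toReal := by
  have hm : Measurable (fun u : ℝ => b ^ u) :=
    (Real.continuous_const_rpow (by positivity)).measurable
  have hs : MeasurableSet (Icc 1 b ∩ Iic t) := measurableSet_Icc.inter measurableSet_Iic
  rw [cdf, benford, Measure.map_apply hm hs, Measure.restrict_apply (hm hs)]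

lemma volume_inter_Ico_ne_top (s : Set ℝ) : volume (s ∩ Ico (0 : ℝ) 1) ≠ ⊤ :=
  measure_ne_top_of_subset inter_subset_right (by simp)

lemma cdf_benford_mono (b : ℝ) (hb : 1 < b) : Monotone (cdf (benford b) 1 b) := by
  intro s t hst
  rw [cdf_benford_eq b hb, cdf_benford_eq b hb]
  refine ENNReal.toReal_mono (volume_inter_Ico_ne_top _) (measure_mono ?_)
  gcongr

lemma cdf_benford_nonneg (b t : ℝ) : 0 ≤ cdf (benford b) 1 b t := ENNReal.toReal_nonneg

lemma cdf_benford_le_one (b : ℝ) (hb : 1 < b) (t : ℝ) : cdf (benford b) 1 b t ≤ 1 := by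
  rw [cdf_benford_eq b hb]
  refine (ENNReal.toReal_mono (by simp) (measure_mono inter_subset_right)).trans ?_
  simp

lemma cdf_benford_rpow (b : ℝ) (hb : 1 < b) {u : ℝ} (hu : u ∈ Icc (0 : ℝ) 1) :
    cdf (benford b) 1 b (b ^ u) = u := by
  have hset : ((fun v : ℝ => b ^ v) ⁻¹' (Icc 1 b ∩ Iic (b ^ u))) ∩ Ico (0 : ℝ) 1
      = Icc 0 u ∩ Ico 0 1 := by
    ext v
    simp only [mem_inter_iff, mem_preimage, mem_Icc, mem_Iic, mem_Ico,
      Real.rpow_le_rpow_left_iff hb]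
    constructor
    · rintro ⟨⟨_, h⟩, h0, h1⟩
      exact ⟨⟨h0, h⟩, h0, h1⟩
    · rintro ⟨⟨_, h⟩, h0, h1⟩
      refine ⟨⟨⟨Real.one_le_rpow hb.le h0, ?_⟩, h⟩, h0, h1⟩
      simpa using Real.rpow_le_rpow_of_exponent_le hb.le h1.le
  rw [cdf_benford_eq b hb, hset]
  have hae : volume (Icc (0 : ℝ) u ∩ Ico 0 1) = volume (Ico (0 : ℝ) u) := by
    apply le_antisymm
    · exact (measure_mono inter_subset_left).trans (by simp)
    · exact measure_mono fun v hv => ⟨⟨hv.1, hv.2.le⟩, hv.1, hv.2.trans_le hu.2⟩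
  rw [hae]
  simp [hu.1]

lemma cdf_benford_le_iff (b : ℝ) (hb : 1 < b) {s : ℝ} (h0 : 0 ≤ s) (h1 : s < 1) (t : ℝ) :
    cdf (benford b) 1 b t ≤ s ↔ t ≤ b ^ s := by
  have hb0 : 0 < b := by linarith
  constructor
  · intro h
    by_contra! hlt
    have ht : 0 < t := (Real.rpow_pos_of_pos hb0 s).trans hlt
    have hs : s < Real.logb b t := (Real.lt_logb_iff_rpow_lt hb ht).2 hlt
    have hm : s < min 1 (Real.logb b t) := lt_min h1 hs
    have hle : b ^ (min 1 (Real.logb b t)) ≤ t :=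
      (Real.le_logb_iff_rpow_le hb ht).1 (min_le_right _ _)
    have := cdf_benford_mono b hb hle
    rw [cdf_benford_rpow b hb ⟨h0.trans hm.le, min_le_left _ _⟩] at this
    linarith
  · intro h
    simpa [cdf_benford_rpow b hb ⟨h0, h1.le⟩] using cdf_benford_mono b hb h

lemma le_cdf_benford_iff (b : ℝ) (hb : 1 < b) {s : ℝ} (h0 : 0 < s) (h1 : s ≤ 1) (t : ℝ) :
    s ≤ cdf (benford b) 1 b t ↔ b ^ s ≤ t := by
  constructor
  · intro h
    by_contra! hlt
    rcases le_total t 1 with ht | ht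
    · have h2 := cdf_benford_mono b hb ht
      have h3 := cdf_benford_rpow b hb (u := 0) ⟨le_rfl, zero_le_one⟩
      rw [Real.rpow_zero] at h3
      linarith
    · have ht0 : 0 < t := by linarith
      have hs : Real.logb b t < s := (Real.logb_lt_iff_lt_rpow hb ht0).2 hlt
      have h3 := cdf_benford_rpow b hb (u := Real.logb b t)
        ⟨Real.logb_nonneg hb ht, hs.le.trans h1⟩
      rw [Real.rpow_logb (by linarith) hb.ne' ht0] at h3
      linarith
  · intro h
    simpa [cdf_benford_rpow b hb ⟨h0.le, h1⟩] using cdf_benford_mono b hb h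

/-! ### The distribution function of a uniform discrete measure -/

lemma cdf_discr_unif {A B : ℝ} {n : ℕ} {x : Fin n → ℝ} (hx : IsXi A B n x) (t : ℝ) :
    cdf (discr n x (unif n)) A B t = ((Finset.univ.filter fun j => x j ≤ t).card : ℝ) / n := by
  have hs : MeasurableSet (Icc A B ∩ Iic t) := measurableSet_Icc.inter measurableSet_Iic
  have hmem : ∀ j, x j ∈ Icc A B ∩ Iic t ↔ x j ≤ t := fun j => by
    simp only [mem_inter_iff, hx.1 j, true_and, mem_Iic]
  have hval : ∀ j, (ENNReal.ofReal (unif n j) • Measure.dirac (x j)) (Icc A B ∩ Iic t)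
      = if x j ≤ t then ENNReal.ofReal (1 / (n : ℝ)) else 0 := by
    intro j
    rw [Measure.smul_apply, Measure.dirac_apply' _ hs, unif]
    by_cases h : x j ≤ t
    · simp [h, indicator_of_mem ((hmem j).2 h)]
    · simp [h]
  rw [cdf, discr, Measure.finsetSum_apply, Finset.sum_congr rfl fun j _ => hval j,
    ← Finset.sum_filter, Finset.sum_const, nsmul_eq_mul, ENNReal.toReal_mul,
    ENNReal.toReal_ofReal (by positivity)]
  simp [div_eq_mul_inv]

lemma card_filter_le_of_lt {n : ℕ} {x : Fin n → ℝ} (hx : Monotone x) {j : Fin n} {t : ℝ}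
    (ht : t < x j) : (Finset.univ.filter fun i => x i ≤ t).card ≤ j := by
  rw [← Fin.card_Iio]
  refine Finset.card_le_card fun i hi => ?_
  simp only [Finset.mem_filter, Finset.mem_univ, true_and] at hi
  rw [Finset.mem_Iio]
  by_contra! h
  linarith [hx h]

lemma succ_le_card_filter_of_le {n : ℕ} {x : Fin n → ℝ} (hx : Monotone x) {j : Fin n} {t : ℝ}
    (ht : x j ≤ t) : (j : ℕ) + 1 ≤ (Finset.univ.filter fun i => x i ≤ t).card := by
  rw [← Fin.card_Iic]
  refine Finset.card_le_card fun i hi => ?_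
  simp only [Finset.mem_filter, Finset.mem_univ, true_and]
  exact (hx (Finset.mem_Iic.1 hi)).trans ht

/-! ### The Lévy distance to the Benford measure -/

/-- The Lévy radii admissible for `x`, described coordinatewise. -/
def levyRadii (b : ℝ) (n : ℕ) (x : Fin n → ℝ) : Set ℝ :=
  {y : ℝ | 0 ≤ y ∧ ∀ j : Fin n, b ^ (((j : ℝ) + 1) / (n : ℝ) - y) - y ≤ x j ∧
    x j ≤ b ^ ((j : ℝ) / (n : ℝ) + y) + y}

lemma setOf_levy_eq_levyRadii (b : ℝ) (hb : 1 < b) {n : ℕ} (hn : 0 < n) {x : Fin n → ℝ}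
    (hx : IsXi 1 b n x) :
    {y : ℝ | 0 ≤ y ∧ ∀ t : ℝ,
      cdf (benford b) 1 b (t - y) - y ≤ cdf (discr n x (unif n)) 1 b t ∧
        cdf (discr n x (unif n)) 1 b t ≤ cdf (benford b) 1 b (t + y) + y} = levyRadii b n x := by
  have hn' : (0 : ℝ) < n := by exact_mod_cast hn
  ext y
  simp only [levyRadii, mem_ofPred_eq]
  refine and_congr_right fun hy => ⟨fun h j => ⟨?_, ?_⟩, fun h t => ⟨?_, ?_⟩⟩
  · have h1 : cdf (discr n x (unif n)) 1 b (x j) ≤ _ := (h (x j)).2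
    rw [cdf_discr_unif hx] at h1
    have hc : ((j : ℝ) + 1) ≤ ((Finset.univ.filter fun i => x i ≤ x j).card : ℝ) := by
      exact_mod_cast succ_le_card_filter_of_le hx.2 le_rfl
    have h2 : ((j : ℝ) + 1) / n - y ≤ cdf (benford b) 1 b (x j + y) := by
      have : ((j : ℝ) + 1) / n ≤ ((Finset.univ.filter fun i => x i ≤ x j).card : ℝ) / n := by
        gcongr
      linarith
    rcases le_or_gt (((j : ℝ) + 1) / n - y) 0 with hneg | hpos
    · have := Real.rpow_le_one_of_one_le_of_nonpos hb.le hneg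
      linarith [(hx.1 j).1]
    · have := (le_cdf_benford_iff b hb hpos (h2.trans (cdf_benford_le_one b hb _)) _).1 h2
      linarith
  · rcases lt_or_ge ((j : ℝ) / n + y) 1 with hlt | hge
    · suffices x j - y ≤ b ^ ((j : ℝ) / n + y) by linarith
      refine le_of_forall_lt fun s hs => ?_
      obtain ⟨s', hs1, hs2⟩ := exists_between hs
      have h1 := (h (s' + y)).1
      rw [cdf_discr_unif hx, add_sub_cancel_right] at h1
      have hc : ((Finset.univ.filter fun i => x i ≤ s' + y).card : ℝ) ≤ (j : ℝ) := by
        exact_mod_cast card_filter_le_of_lt hx.2 (by linarith : s' + y < x j)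
      have h2 : ((Finset.univ.filter fun i => x i ≤ s' + y).card : ℝ) / n ≤ (j : ℝ) / n := by
        gcongr
      have h3 : cdf (benford b) 1 b s' ≤ (j : ℝ) / n + y := by linarith
      exact hs1.trans_le ((cdf_benford_le_iff b hb (by positivity) hlt _).1 h3)
    · have := Real.rpow_le_rpow_of_exponent_le hb.le hge
      rw [Real.rpow_one] at this
      linarith [(hx.1 j).2]
  · rw [cdf_discr_unif hx]
    set k := (Finset.univ.filter fun i => x i ≤ t).card with hk
    have hkn : k ≤ n := by simpa using Finset.card_le_univ (Finset.univ.filter fun i => x i ≤ t)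
    rcases hkn.eq_or_lt with hkn | hkn
    · rw [hkn, div_self hn'.ne']
      linarith [cdf_benford_le_one b hb (t - y)]
    · have htx : t < x ⟨k, hkn⟩ := by
        by_contra! hle
        have := succ_le_card_filter_of_le hx.2 hle
        simp only at this
        omega
      have h1 := (h ⟨k, hkn⟩).2
      simp only at h1
      rcases lt_or_ge ((k : ℝ) / n + y) 1 with hlt | hge
      · have := (cdf_benford_le_iff b hb (by positivity) hlt (t - y)).2 (by linarith)
        linarith
      · linarith [cdf_benford_le_one b hb (t - y)]
  · rw [cdf_discr_unif hx]
    set k := (Finset.univ.filter fun i => x i ≤ t).card with hk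
    have hkn : k ≤ n := by simpa using Finset.card_le_univ (Finset.univ.filter fun i => x i ≤ t)
    rcases Nat.eq_zero_or_pos k with hk0 | hkpos
    · rw [hk0]
      have := cdf_benford_nonneg b (t + y)
      simp only [Nat.cast_zero, zero_div]
      linarith
    · have hlt : k - 1 < n := by omega
      have htx : x ⟨k - 1, hlt⟩ ≤ t := by
        by_contra! hgt
        have := card_filter_le_of_lt hx.2 hgt
        simp only at this
        omega
      have h1 := (h ⟨k - 1, hlt⟩).1
      have hcast : ((k - 1 : ℕ) : ℝ) + 1 = k := by
        rw [Nat.cast_sub hkpos]; simp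
      simp only [hcast] at h1
      have hk1 : (k : ℝ) / n ≤ 1 := by
        rw [div_le_one hn']; exact_mod_cast hkn
      rcases le_or_gt ((k : ℝ) / n - y) 0 with hneg | hpos
      · linarith [cdf_benford_nonneg b (t + y)]
      · have := (le_cdf_benford_iff b hb hpos (by linarith) (t + y)).2 (by linarith)
        linarith

lemma omegaI_pos {b : ℝ} (hb : 1 < b) : 0 < omegaI 1 b :=
  div_pos (lt_max_of_lt_left one_pos) (by linarith)

lemma omegaI_one_left (b : ℝ) : omegaI 1 b = (max b 2 - 1) / (b - 1) := by
  rw [omegaI, max_comm, ← max_sub_sub_right]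
  norm_num

lemma isClosed_levyRadii {b : ℝ} (hb : 1 < b) (n : ℕ) (x : Fin n → ℝ) :
    IsClosed (levyRadii b n x) := by
  have hc := Real.continuous_const_rpow (a := b) (by positivity)
  simp only [levyRadii, ofPred_and, ofPred_forall]
  refine isClosed_Ici.inter (isClosed_iInter fun j => IsClosed.inter ?_ ?_)
  · exact isClosed_le ((hc.comp (by fun_prop)).sub continuous_id) continuous_const
  · exact isClosed_le continuous_const ((hc.comp (by fun_prop)).add continuous_id)

lemma one_mem_levyRadii {b : ℝ} (hb : 1 < b) {n : ℕ} {x : Fin n → ℝ}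
    (hx : IsXi 1 b n x) : (1 : ℝ) ∈ levyRadii b n x := by
  refine ⟨zero_le_one, fun j => ⟨?_, ?_⟩⟩
  · have hn' : (0 : ℝ) < n := by exact_mod_cast j.pos
    have h1 : ((j : ℝ) + 1) / n - 1 ≤ 0 := by
      rw [sub_nonpos, div_le_one hn']
      exact_mod_cast j.2
    linarith [Real.rpow_le_one_of_one_le_of_nonpos hb.le h1, (hx.1 j).1]
  · have h1 : (1 : ℝ) ≤ (j : ℝ) / n + 1 := by
      have : (0 : ℝ) ≤ (j : ℝ) / n := by positivity
      linarith
    have := Real.rpow_le_rpow_of_exponent_le hb.le h1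
    rw [Real.rpow_one] at this
    linarith [(hx.1 j).2]

/-! ### The equation for the optimal radius -/

lemma strictMono_radiusFun {b : ℝ} (hb : 1 < b) (r : ℝ) :
    StrictMono fun L : ℝ => 2 * L - (b ^ (1 - L) - b ^ (1 + L - r)) := by
  intro s t hst
  have h1 : b ^ (1 - t) < b ^ (1 - s) := Real.rpow_lt_rpow_of_exponent_lt hb (by linarith)
  have h2 : b ^ (1 + s - r) < b ^ (1 + t - r) := Real.rpow_lt_rpow_of_exponent_lt hb (by linarith)
  simp only
  linarith

lemma existsUnique_radius {b : ℝ} (hb : 1 < b) {r : ℝ} (hr : 0 < r) :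
    ∃! L : ℝ, 2 * L = b ^ (1 - L) - b ^ (1 + L - r) := by
  have hc := Real.continuous_const_rpow (a := b) (by positivity)
  have hcont : Continuous fun L : ℝ => 2 * L - (b ^ (1 - L) - b ^ (1 + L - r)) :=
    (by fun_prop : Continuous fun L : ℝ => 2 * L).sub
      ((hc.comp (by fun_prop)).sub (hc.comp (by fun_prop)))
  have h0 : 2 * (0 : ℝ) - (b ^ (1 - (0 : ℝ)) - b ^ (1 + (0 : ℝ) - r)) ≤ 0 := by
    have : b ^ (1 + (0 : ℝ) - r) < b ^ (1 - (0 : ℝ)) :=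
      Real.rpow_lt_rpow_of_exponent_lt hb (by linarith)
    linarith
  have h1 : 0 ≤ 2 * (r / 2) - (b ^ (1 - r / 2) - b ^ (1 + r / 2 - r)) := by
    rw [show 1 + r / 2 - r = 1 - r / 2 by ring]
    linarith
  obtain ⟨L, -, hL⟩ := intermediate_value_Icc (by positivity : (0 : ℝ) ≤ r / 2)
    hcont.continuousOn ⟨h0, h1⟩
  simp only at hL
  refine ⟨L, by simp only; linarith, fun L' hL' => ?_⟩
  apply (strictMono_radiusFun hb r).injective
  simp only at hL' ⊢
  linarith

lemma radius_pos {b : ℝ} (hb : 1 < b) {r L : ℝ} (hr : 0 < r)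
    (hL : 2 * L = b ^ (1 - L) - b ^ (1 + L - r)) : 0 < L := by
  by_contra! h
  have : b ^ (1 + L - r) < b ^ (1 - L) := Real.rpow_lt_rpow_of_exponent_lt hb (by linarith)
  linarith

lemma two_mul_radius_lt {b : ℝ} (hb : 1 < b) {r L : ℝ} (hr : 0 < r)
    (hL : 2 * L = b ^ (1 - L) - b ^ (1 + L - r)) : 2 * L < r := by
  by_contra! h
  have : b ^ (1 - L) ≤ b ^ (1 + L - r) := Real.rpow_le_rpow_of_exponent_le hb.le (by linarith)
  linarith

lemma mul_rpow_le_rpow_sub_rpow {b : ℝ} (hb : 0 < b) (u v : ℝ) :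
    Real.log b * (u - v) * b ^ v ≤ b ^ u - b ^ v := by
  have h1 := Real.add_one_le_exp (Real.log b * (u - v))
  have h2 : b ^ u = Real.exp (Real.log b * (u - v)) * b ^ v := by
    rw [Real.rpow_def_of_pos hb, Real.rpow_def_of_pos hb, ← Real.exp_add]
    ring_nf
  have h3 := Real.rpow_pos_of_pos hb v
  rw [h2]
  nlinarith

lemma two_mul_radius_le {b : ℝ} (hb : 1 < b) {r L : ℝ} (hr : 0 < r)
    (hL : 2 * L = b ^ (1 - L) - b ^ (1 + L - r)) :
    2 * L ≤ Real.log b * b * (r - 2 * L) := by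
  have h1 := mul_rpow_le_rpow_sub_rpow (by linarith : 0 < b) (1 + L - r) (1 - L)
  have h2 := two_mul_radius_lt hb hr hL
  have h3 : b ^ (1 - L) ≤ b := by
    simpa using Real.rpow_le_rpow_of_exponent_le hb.le
      (by linarith [radius_pos hb hr hL] : 1 - L ≤ 1)
  have h4 : 0 ≤ Real.log b * (r - 2 * L) := mul_nonneg (Real.log_pos hb).le (by linarith)
  nlinarith [mul_le_mul_of_nonneg_left h3 h4]

lemma le_two_mul_radius {b : ℝ} (hb : 1 < b) {r L : ℝ} (hr : 0 < r)
    (hL : 2 * L = b ^ (1 - L) - b ^ (1 + L - r)) :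
    Real.log b * b ^ (1 - r) * (r - 2 * L) ≤ 2 * L := by
  have h1 := mul_rpow_le_rpow_sub_rpow (by linarith : 0 < b) (1 - L) (1 + L - r)
  have h2 := two_mul_radius_lt hb hr hL
  have h3 : b ^ (1 - r) ≤ b ^ (1 + L - r) :=
    Real.rpow_le_rpow_of_exponent_le hb.le (by linarith [radius_pos hb hr hL])
  have h4 : 0 ≤ Real.log b * (r - 2 * L) := mul_nonneg (Real.log_pos hb).le (by linarith)
  nlinarith [mul_le_mul_of_nonneg_left h3 h4]

lemma two_mul_radius_lt_log_mul {b : ℝ} (hb : 1 < b) {r L : ℝ} (hr : 0 < r)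
    (hL : 2 * L = b ^ (1 - L) - b ^ (1 + L - r)) :
    2 * L < Real.log b * (2 * r - 2 * L) := by
  have h1 := two_mul_radius_le hb hr hL
  have hc := Real.log_pos hb
  have hexp : b * (1 - Real.log b) ≤ 1 := by
    have h := Real.add_one_le_exp (-Real.log b)
    rw [Real.exp_neg, Real.exp_log (by linarith)] at h
    calc b * (1 - Real.log b) ≤ b * b⁻¹ := by gcongr; linarith
      _ = 1 := mul_inv_cancel₀ (by linarith)
  set c := Real.log b
  by_contra! h
  have h2 : 2 * c * r * (1 + c * b) ≤ 2 * L * (1 + c) * (1 + c * b) :=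
    mul_le_mul_of_nonneg_right (by linarith) (by positivity)
  have h3 : 2 * L * (1 + c * b) * (1 + c) ≤ c * b * r * (1 + c) :=
    mul_le_mul_of_nonneg_right (by linarith) (by positivity)
  have h4 : (c * r) * (2 + b * c - b) ≤ 0 := by linarith
  have h5 : 0 < c * r := mul_pos hc hr
  nlinarith

/-! ### Best uniform approximations -/

lemma radius_le_of_mem_levyRadii {b : ℝ} (hb : 1 < b) {n : ℕ} (hn : 0 < n) {L : ℝ}
    (hL : 2 * L = b ^ (1 - L) - b ^ (1 + L - 1 / (n : ℝ))) {x : Fin n → ℝ} {y : ℝ}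
    (hy : y ∈ levyRadii b n x) : L ≤ y := by
  have hn' : (n : ℝ) ≠ 0 := by positivity
  obtain ⟨h1, h2⟩ := hy.2 ⟨n - 1, by omega⟩
  have hcast : ((n - 1 : ℕ) : ℝ) = n - 1 := by rw [Nat.cast_sub hn]; simp
  simp only [hcast] at h1 h2
  rw [show ((n : ℝ) - 1 + 1) / n - y = 1 - y by field_simp; ring] at h1
  rw [show ((n : ℝ) - 1) / n + y = 1 + y - 1 / n by field_simp; ring] at h2
  rw [← (strictMono_radiusFun hb (1 / (n : ℝ))).le_iff_le]
  linarith

lemma exists_radius_mem_levyRadii {b : ℝ} (hb : 1 < b) {n : ℕ} (hn : 0 < n) {L : ℝ}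
    (hL : 2 * L = b ^ (1 - L) - b ^ (1 + L - 1 / (n : ℝ))) :
    ∃ x : Fin n → ℝ, IsXi 1 b n x ∧ L ∈ levyRadii b n x := by
  have hn' : (0 : ℝ) < n := by exact_mod_cast hn
  have hb0 : 0 < b := by linarith
  have hr : (0 : ℝ) < 1 / n := by positivity
  have hpos := radius_pos hb hr hL
  have hlt := two_mul_radius_lt hb hr hL
  refine ⟨fun j => max 1 (b ^ (((j : ℝ) + 1) / n - L) - L), ⟨fun j => ⟨le_max_left _ _, ?_⟩, ?_⟩,
    hpos.le, fun j => ⟨le_max_right _ _, ?_⟩⟩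
  · refine max_le hb.le ?_
    have h1 : ((j : ℝ) + 1) / n ≤ 1 := by
      rw [div_le_one hn']
      exact_mod_cast j.2
    have h2 := Real.rpow_le_rpow_of_exponent_le hb.le (by linarith : ((j : ℝ) + 1) / n - L ≤ 1)
    rw [Real.rpow_one] at h2
    linarith
  · intro i j hij
    have hij' : (i : ℝ) ≤ j := by exact_mod_cast hij
    simp only
    gcongr
    exact hb.le
  · have hj : (0 : ℝ) ≤ (j : ℝ) / n := by positivity
    refine max_le ?_ ?_
    · linarith [Real.one_le_rpow hb.le (by linarith : 0 ≤ (j : ℝ) / n + L)]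
    · have hj1 : ((j : ℝ) + 1) / n ≤ 1 := by
        rw [div_le_one hn']
        exact_mod_cast j.2
      set s := 1 - ((j : ℝ) + 1) / n with hs
      have hs1 : 1 ≤ b ^ s := Real.one_le_rpow hb.le (by linarith)
      have e1 : b ^ (1 - L) = b ^ s * b ^ (((j : ℝ) + 1) / n - L) := by
        rw [← Real.rpow_add hb0, hs]; ring_nf
      have e2 : b ^ (1 + L - 1 / (n : ℝ)) = b ^ s * b ^ ((j : ℝ) / n + L) := by
        rw [← Real.rpow_add hb0, hs]; ring_nf
      have hle : b ^ ((j : ℝ) / n + L) ≤ b ^ (((j : ℝ) + 1) / n - L) :=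
        Real.rpow_le_rpow_of_exponent_le hb.le (by rw [add_div]; linarith)
      rw [e1, e2] at hL
      nlinarith

lemma strictMono_of_radius_mem_levyRadii {b : ℝ} (hb : 1 < b) {n : ℕ} {L : ℝ}
    (hL : 2 * L = b ^ (1 - L) - b ^ (1 + L - 1 / (n : ℝ))) {x : Fin n → ℝ}
    (hx : L ∈ levyRadii b n x) : StrictMono x := by
  intro i j hij
  have hn' : (0 : ℝ) < n := by exact_mod_cast i.pos
  have hr : (0 : ℝ) < 1 / n := by positivity
  have h1 := mul_rpow_le_rpow_sub_rpow (by linarith : 0 < b) (((j : ℝ) + 1) / n - L)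
    ((i : ℝ) / n + L)
  have hpos := radius_pos hb hr hL
  have hlt := two_mul_radius_lt hb hr hL
  have h2 := two_mul_radius_lt_log_mul hb hr hL
  have h3 : 1 ≤ b ^ ((i : ℝ) / n + L) := Real.one_le_rpow hb.le (by positivity)
  have h4 : (i : ℝ) + 1 ≤ j := by exact_mod_cast hij
  have h5 : 2 * (1 / (n : ℝ)) - 2 * L ≤ ((j : ℝ) + 1) / n - L - ((i : ℝ) / n + L) := by
    have : ((i : ℝ) + 2) / n ≤ ((j : ℝ) + 1) / n :=
      div_le_div_of_nonneg_right (by linarith) hn'.le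
    have e : ((i : ℝ) + 2) / n = (i : ℝ) / n + 2 * (1 / n) := by ring
    linarith
  have h6 := mul_le_mul_of_nonneg_left h5 (Real.log_pos hb).le
  have h7 : 0 < Real.log b * (2 * (1 / (n : ℝ)) - 2 * L) := by linarith
  have h8 := le_mul_of_one_le_right (h7.le.trans h6) h3
  linarith [(hx.2 i).2, (hx.2 j).1]

lemma omegaI_mul_radius_le_dLevy {b : ℝ} (hb : 1 < b) {n : ℕ} (hn : 0 < n) {L : ℝ}
    (hL : 2 * L = b ^ (1 - L) - b ^ (1 + L - 1 / (n : ℝ)))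
    {x : Fin n → ℝ} (hx : IsXi 1 b n x) :
    omegaI 1 b * L ≤ dLevy 1 b (benford b) (discr n x (unif n)) := by
  rw [dLevy, setOf_levy_eq_levyRadii b hb hn hx]
  exact mul_le_mul_of_nonneg_left
    (le_csInf ⟨1, one_mem_levyRadii hb hx⟩ fun y hy => radius_le_of_mem_levyRadii hb hn hL hy)
    (omegaI_pos hb).le

lemma dLevy_eq_iff_radius_mem_levyRadii {b : ℝ} (hb : 1 < b) {n : ℕ} (hn : 0 < n) {L : ℝ}
    (hL : 2 * L = b ^ (1 - L) - b ^ (1 + L - 1 / (n : ℝ)))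
    {x : Fin n → ℝ} (hx : IsXi 1 b n x) :
    dLevy 1 b (benford b) (discr n x (unif n)) = omegaI 1 b * L ↔ L ∈ levyRadii b n x := by
  have hlow : ∀ y ∈ levyRadii b n x, L ≤ y := fun y hy => radius_le_of_mem_levyRadii hb hn hL hy
  rw [dLevy, setOf_levy_eq_levyRadii b hb hn hx, mul_right_inj' (omegaI_pos hb).ne']
  constructor
  · intro h
    rw [← h]
    exact (isClosed_levyRadii hb n x).csInf_mem ⟨1, one_mem_levyRadii hb hx⟩ ⟨L, hlow⟩
  · intro h
    exact IsLeast.csInf_eq ⟨h, hlow⟩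

lemma isBest_iff_dLevy_eq {b : ℝ} (hb : 1 < b) {n : ℕ} (hn : 0 < n) {L : ℝ}
    (hL : 2 * L = b ^ (1 - L) - b ^ (1 + L - 1 / (n : ℝ)))
    {x : Fin n → ℝ} (hx : IsXi 1 b n x) :
    (∀ y : Fin n → ℝ, IsXi 1 b n y →
      dLevy 1 b (benford b) (discr n x (unif n)) ≤ dLevy 1 b (benford b) (discr n y (unif n))) ↔
    dLevy 1 b (benford b) (discr n x (unif n)) = omegaI 1 b * L := by
  constructor
  · intro h
    obtain ⟨y, hy, hmem⟩ := exists_radius_mem_levyRadii hb hn hL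
    exact le_antisymm ((h y hy).trans_eq
      ((dLevy_eq_iff_radius_mem_levyRadii hb hn hL hy).2 hmem))
      (omegaI_mul_radius_le_dLevy hb hn hL hx)
  · intro h y hy
    rw [h]
    exact omegaI_mul_radius_le_dLevy hb hn hL hy

lemma sInf_dLevy_eq {b : ℝ} (hb : 1 < b) {n : ℕ} (hn : 0 < n) {L : ℝ}
    (hL : 2 * L = b ^ (1 - L) - b ^ (1 + L - 1 / (n : ℝ))) :
    sInf {c : ℝ | ∃ y : Fin n → ℝ, IsXi 1 b n y ∧
      c = dLevy 1 b (benford b) (discr n y (unif n))} = omegaI 1 b * L := by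
  obtain ⟨y, hy, hmem⟩ := exists_radius_mem_levyRadii hb hn hL
  refine IsLeast.csInf_eq
    ⟨⟨y, hy, ((dLevy_eq_iff_radius_mem_levyRadii hb hn hL hy).2 hmem).symm⟩, ?_⟩
  rintro c ⟨z, hz, rfl⟩
  exact omegaI_mul_radius_le_dLevy hb hn hL hz

lemma tendsto_mul_radius {b : ℝ} (hb : 1 < b) {L : ℕ → ℝ}
    (hL : ∀ m : ℕ, 0 < m → 2 * L m = b ^ (1 - L m) - b ^ (1 + L m - 1 / (m : ℝ))) :
    Tendsto (fun m : ℕ => (m : ℝ) * L m) atTop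
      (nhds (b * Real.log b / (1 + b * Real.log b) / 2)) := by
  have hc := Real.log_pos hb
  have hb0 : 0 < b := by linarith
  have hlim : Tendsto (fun m : ℕ => Real.log b * b ^ (1 - 1 / (m : ℝ))) atTop
      (nhds (b * Real.log b)) := by
    have h1 : Tendsto (fun m : ℕ => 1 - 1 / (m : ℝ)) atTop (nhds (1 - 0)) :=
      tendsto_const_nhds.sub tendsto_one_div_atTop_nhds_zero_nat
    have h2 := ((Real.continuous_const_rpow hb0.ne').tendsto (1 - 0)).comp h1
    rw [sub_zero, Real.rpow_one] at h2
    rw [mul_comm b]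
    exact h2.const_mul _
  have hlow : Tendsto (fun m : ℕ => Real.log b * b ^ (1 - 1 / (m : ℝ)) /
      (1 + Real.log b * b ^ (1 - 1 / (m : ℝ))) / 2) atTop
      (nhds (b * Real.log b / (1 + b * Real.log b) / 2)) :=
    (hlim.div (hlim.const_add 1) (by positivity)).div_const 2
  refine tendsto_of_tendsto_of_tendsto_of_le_of_le' hlow tendsto_const_nhds ?_ ?_
  · filter_upwards [eventually_gt_atTop 0] with m hm
    have hm' : (0 : ℝ) < m := by exact_mod_cast hm
    have h := le_two_mul_radius hb (by positivity) (hL m hm)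
    have hk : 0 < Real.log b * b ^ (1 - 1 / (m : ℝ)) := by positivity
    set k := Real.log b * b ^ (1 - 1 / (m : ℝ))
    have h' := mul_le_mul_of_nonneg_left h hm'.le
    have e : (m : ℝ) * (k * (1 / m - 2 * L m)) = k - 2 * k * (m * L m) := by field_simp
    rw [e] at h'
    rw [div_div, div_le_iff₀ (by positivity)]
    linarith
  · filter_upwards [eventually_gt_atTop 0] with m hm
    have hm' : (0 : ℝ) < m := by exact_mod_cast hm
    have h := two_mul_radius_le hb (by positivity) (hL m hm)
    have h' := mul_le_mul_of_nonneg_left h hm'.le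
    have e : (m : ℝ) * (Real.log b * b * (1 / m - 2 * L m))
        = b * Real.log b - 2 * (b * Real.log b) * (m * L m) := by field_simp
    rw [e] at h'
    rw [div_div, le_div_iff₀ (by positivity)]
    linarith

/-- Cor. 3.7: characterization of best uniform Lévy-distance
approximations of the Benford measure `β_b`, their common distance `ω_b·L`, and the
uniform quantization coefficient. -/
theorem best_uniform_dLevy_benford (b : ℝ) (hb : 1 < b) (n : ℕ) (hn : 0 < n) :
    (∃! L : ℝ, 2 * L = b ^ (1 - L) - b ^ (1 + L - 1 / (n : ℝ))) ∧
    (∀ L : ℝ, 2 * L = b ^ (1 - L) - b ^ (1 + L - 1 / (n : ℝ)) →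
      ∀ x : Fin n → ℝ, IsXi 1 b n x →
        (((∀ y : Fin n → ℝ, IsXi 1 b n y →
            dLevy 1 b (benford b) (discr n x (unif n)) ≤
              dLevy 1 b (benford b) (discr n y (unif n))) ↔
          (∀ j : Fin n,
            b ^ (((j : ℝ) + 1) / (n : ℝ) - L) - L ≤ x j ∧
              x j ≤ b ^ ((j : ℝ) / (n : ℝ) + L) + L)) ∧
        ((∀ y : Fin n → ℝ, IsXi 1 b n y →
            dLevy 1 b (benford b) (discr n x (unif n)) ≤
              dLevy 1 b (benford b) (discr n y (unif n))) →
          (Set.range x).ncard = n ∧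
            dLevy 1 b (benford b) (discr n x (unif n)) = (max b 2 - 1) / (b - 1) * L))) ∧
    Filter.Tendsto
      (fun m : ℕ => (m : ℝ) * sInf {c : ℝ | ∃ y : Fin m → ℝ, IsXi 1 b m y ∧
        c = dLevy 1 b (benford b) (discr m y (unif m))})
      Filter.atTop
      (nhds ((max b 2 - 1) / (2 * b - 2) * (b * Real.log b / (1 + b * Real.log b)))) := by
  have hn' : (0 : ℝ) < n := by exact_mod_cast hn
  refine ⟨existsUnique_radius hb (by positivity), fun L hL x hx => ?_, ?_⟩
  · have hbest := isBest_iff_dLevy_eq hb hn hL hx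
    have hmem := dLevy_eq_iff_radius_mem_levyRadii hb hn hL hx
    refine ⟨hbest.trans (hmem.trans
      (and_iff_right (radius_pos hb (by positivity) hL).le)), fun h => ⟨?_, ?_⟩⟩
    · have hinj := (strictMono_of_radius_mem_levyRadii hb hL (hmem.1 (hbest.1 h))).injective
      rw [← image_univ, ncard_image_of_injective _ hinj, ncard_univ, Nat.card_fin]
    · rw [hbest.1 h, omegaI_one_left]
  · have hex : ∀ m : ℕ, ∃ L : ℝ, 0 < m → 2 * L = b ^ (1 - L) - b ^ (1 + L - 1 / (m : ℝ)) := by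
      intro m
      rcases Nat.eq_zero_or_pos m with hm | hm
      · exact ⟨0, fun h => absurd hm h.ne'⟩
      · have hm' : (0 : ℝ) < m := by exact_mod_cast hm
        obtain ⟨L, hL, -⟩ := existsUnique_radius hb (r := 1 / (m : ℝ)) (by positivity)
        exact ⟨L, fun _ => hL⟩
    choose L hL using hex
    have hlim := (tendsto_mul_radius hb hL).const_mul (omegaI 1 b)
    have hval : (max b 2 - 1) / (2 * b - 2) * (b * Real.log b / (1 + b * Real.log b))
        = omegaI 1 b * (b * Real.log b / (1 + b * Real.log b) / 2) := by
      rw [omegaI_one_left, show 2 * b - 2 = (b - 1) * 2 by ring, ← div_div]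
      ring
    rw [hval]
    refine hlim.congr' ?_
    filter_upwards [eventually_gt_atTop 0] with m hm
    rw [sInf_dLevy_eq hb hm (hL m hm)]
    ring

end BenfordApprox
end
end
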